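/- Weak representation theorem for ES quasifusion operators: an ES combination operator ∇ on an epistemic space (ℰ, B, ℒ_𝒫) is an ES quasifusion operator (i.e., satisfies (ESF1)–(ESF7) and (ESF8W)) if and only if there exists a unique quasifaithful assignment Φ ↦ ≽_Φ that represents ∇, i.e., such that [B(∇(Φ,E))] = max([B(E)], ≽_Φ) for every profile Φ and every epistemic state E. -/

import Mathlib

/- Common framework for logic-based merging of epistemic states
   (Mata Díaz & Pino Pérez, "Impossibility in Belief Merging"). -/

namespace BeliefMerging

/-- A profile: a nonempty finite society of agents together with an
assignment of an epistemic state to each agent of the society. -/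
structure Profile (S ℰ : Type) where
  soc : Finset S
  soc_nonempty : soc.Nonempty
  val : {x // x ∈ soc} → ℰ

variable {S ℰ W : Type}

/-- The singleton profile of agent `i` with epistemic state `E`. -/
def Profile.single (i : S) (E : ℰ) : Profile S ℰ :=
  ⟨{i}, Finset.singleton_nonempty i, fun _ => E⟩

/-- Restriction of a profile to a nonempty subsociety. -/
def Profile.restrict (Φ : Profile S ℰ) (M : Finset S) (hM : M.Nonempty)
    (hsub : M ⊆ Φ.soc) : Profile S ℰ :=
  ⟨M, hM, fun i => Φ.val ⟨i.1, hsub i.2⟩⟩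

/-- Equivalence of profiles: societies of the same cardinality whose states
correspond under the unique order-preserving bijection. -/
def Profile.Equiv [LinearOrder S] (Φ Ψ : Profile S ℰ) : Prop :=
  ∃ h : Φ.soc.card = Ψ.soc.card,
    ∀ k : Fin Φ.soc.card,
      Φ.val (Φ.soc.orderIsoOfFin rfl k) = Ψ.val (Ψ.soc.orderIsoOfFin h.symm k)

/-- (ESF1) -/
def ESF1 (B : ℰ → Set W) (nab : Profile S ℰ → ℰ → ℰ) : Prop :=
  ∀ (Φ : Profile S ℰ) (E : ℰ), B (nab Φ E) ⊆ B E

/-- (ESF2) -/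
def ESF2 [LinearOrder S] (B : ℰ → Set W) (nab : Profile S ℰ → ℰ → ℰ) : Prop :=
  ∀ (Φ Φ' : Profile S ℰ) (E E' : ℰ), Profile.Equiv Φ Φ' → B E = B E' →
    B (nab Φ E) = B (nab Φ' E')

/-- (ESF3) -/
def ESF3 (B : ℰ → Set W) (nab : Profile S ℰ → ℰ → ℰ) : Prop :=
  ∀ (Φ : Profile S ℰ) (E E' E'' : ℰ), B E = B E' ∩ B E'' →
    B (nab Φ E') ∩ B E'' ⊆ B (nab Φ E)

/-- (ESF4) -/
def ESF4 (B : ℰ → Set W) (nab : Profile S ℰ → ℰ → ℰ) : Prop :=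
  ∀ (Φ : Profile S ℰ) (E E' E'' : ℰ), B E = B E' ∩ B E'' →
    (B (nab Φ E') ∩ B E'').Nonempty →
    B (nab Φ E) ⊆ B (nab Φ E') ∩ B E''

/-- ES basic fusion operator: (ESF1)–(ESF4). -/
def BasicFusion [LinearOrder S] (B : ℰ → Set W) (nab : Profile S ℰ → ℰ → ℰ) : Prop :=
  ESF1 B nab ∧ ESF2 B nab ∧ ESF3 B nab ∧ ESF4 B nab

/-- (ESF5) -/
def ESF5 (B : ℰ → Set W) (nab : Profile S ℰ → ℰ → ℰ) : Prop :=
  ∀ (j k : S) (Ej Ek : ℰ), Ej ≠ Ek →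
    ∃ E' : ℰ, B (nab (Profile.single j Ej) E') ≠ B (nab (Profile.single k Ek) E')

/-- (ESF6) -/
def ESF6 (B : ℰ → Set W) (nab : Profile S ℰ → ℰ → ℰ) : Prop :=
  ∀ (Φ : Profile S ℰ) (E : ℰ),
    ((⋂ i : {x // x ∈ Φ.soc}, B (Φ.val i)) ∩ B E).Nonempty →
    B (nab Φ E) = (⋂ i : {x // x ∈ Φ.soc}, B (Φ.val i)) ∩ B E

/-- (ESF7) -/
def ESF7 [DecidableEq S] (B : ℰ → Set W) (nab : Profile S ℰ → ℰ → ℰ) : Prop :=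
  ∀ (Φ : Profile S ℰ) (N₁ N₂ : Finset S) (h₁ : N₁.Nonempty) (h₂ : N₂.Nonempty)
    (hs₁ : N₁ ⊆ Φ.soc) (hs₂ : N₂ ⊆ Φ.soc),
    Disjoint N₁ N₂ → N₁ ∪ N₂ = Φ.soc → ∀ E : ℰ,
      B (nab (Φ.restrict N₁ h₁ hs₁) E) ∩ B (nab (Φ.restrict N₂ h₂ hs₂) E) ⊆
        B (nab Φ E)

/-- (ESF8) -/
def ESF8 [DecidableEq S] (B : ℰ → Set W) (nab : Profile S ℰ → ℰ → ℰ) : Prop :=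
  ∀ (Φ : Profile S ℰ) (N₁ N₂ : Finset S) (h₁ : N₁.Nonempty) (h₂ : N₂.Nonempty)
    (hs₁ : N₁ ⊆ Φ.soc) (hs₂ : N₂ ⊆ Φ.soc),
    Disjoint N₁ N₂ → N₁ ∪ N₂ = Φ.soc → ∀ E : ℰ,
      (B (nab (Φ.restrict N₁ h₁ hs₁) E) ∩ B (nab (Φ.restrict N₂ h₂ hs₂) E)).Nonempty →
      B (nab Φ E) ⊆
        B (nab (Φ.restrict N₁ h₁ hs₁) E) ∩ B (nab (Φ.restrict N₂ h₂ hs₂) E)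

/-- (ESF8W) -/
def ESF8W [DecidableEq S] (B : ℰ → Set W) (nab : Profile S ℰ → ℰ → ℰ) : Prop :=
  ∀ (Φ : Profile S ℰ) (N₁ N₂ : Finset S) (h₁ : N₁.Nonempty) (h₂ : N₂.Nonempty)
    (hs₁ : N₁ ⊆ Φ.soc) (hs₂ : N₂ ⊆ Φ.soc),
    Disjoint N₁ N₂ → N₁ ∪ N₂ = Φ.soc → ∀ E : ℰ,
      (B (nab (Φ.restrict N₁ h₁ hs₁) E) ∩ B (nab (Φ.restrict N₂ h₂ hs₂) E)).Nonempty →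
      B (nab Φ E) ⊆
        B (nab (Φ.restrict N₁ h₁ hs₁) E) ∪ B (nab (Φ.restrict N₂ h₂ hs₂) E)

/-- ES fusion operator: (ESF1)–(ESF8). -/
def Fusion [LinearOrder S] (B : ℰ → Set W) (nab : Profile S ℰ → ℰ → ℰ) : Prop :=
  BasicFusion B nab ∧ ESF5 B nab ∧ ESF6 B nab ∧ ESF7 B nab ∧ ESF8 B nab

/-- ES quasifusion operator: (ESF1)–(ESF7) and (ESF8W). -/
def Quasifusion [LinearOrder S] (B : ℰ → Set W) (nab : Profile S ℰ → ℰ → ℰ) : Prop :=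
  BasicFusion B nab ∧ ESF5 B nab ∧ ESF6 B nab ∧ ESF7 B nab ∧ ESF8W B nab

/-- (ESF-SD), Standard Domain. -/
def ESFSD (B : ℰ → Set W) (nab : Profile S ℰ → ℰ → ℰ) : Prop :=
  ∀ (i : S) (w w' w'' : W), w ≠ w' → w ≠ w'' → w' ≠ w'' →
  ∀ (E₁ E₂ : ℰ), B E₁ = {w, w'} → B E₂ = {w', w''} →
    (∃ Ei : ℰ, B (nab (Profile.single i Ei) E₁) = {w, w'} ∧
               B (nab (Profile.single i Ei) E₂) = {w', w''}) ∧
    (∃ Ei : ℰ, B (nab (Profile.single i Ei) E₁) = {w, w'} ∧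
               B (nab (Profile.single i Ei) E₂) = {w'}) ∧
    (∃ Ei : ℰ, B (nab (Profile.single i Ei) E₁) = {w} ∧
               B (nab (Profile.single i Ei) E₂) = {w', w''}) ∧
    (∃ Ei : ℰ, B (nab (Profile.single i Ei) E₁) = {w} ∧
               B (nab (Profile.single i Ei) E₂) = {w'})

/-- (ESF-U), Unanimity. -/
def ESFU (B : ℰ → Set W) (nab : Profile S ℰ → ℰ → ℰ) : Prop :=
  ∀ (Φ : Profile S ℰ), (∀ i j : {x // x ∈ Φ.soc}, Φ.val i = Φ.val j) →
    ∀ (E : ℰ) (i : {x // x ∈ Φ.soc}),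
      B (nab Φ E) = B (nab (Profile.single i.1 (Φ.val i)) E)

/-- (ESF-P), Pareto. -/
def ESFP (B : ℰ → Set W) (nab : Profile S ℰ → ℰ → ℰ) : Prop :=
  ∀ (Φ : Profile S ℰ) (E E' : ℰ),
    (⋂ i : {x // x ∈ Φ.soc}, B (nab (Profile.single i.1 (Φ.val i)) E)).Nonempty →
    (∀ i : {x // x ∈ Φ.soc}, B (nab (Profile.single i.1 (Φ.val i)) E) ∩ B E' = ∅) →
    B (nab Φ E) ∩ B E' = ∅

/-- (ESF-I), Independence. -/
def ESFI (B : ℰ → Set W) (nab : Profile S ℰ → ℰ → ℰ) : Prop :=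
  ∀ (N : Finset S) (hN : N.Nonempty) (f g : {x // x ∈ N} → ℰ) (E : ℰ),
    (∀ E' : ℰ, B E' ⊆ B E → ∀ j : {x // x ∈ N},
      B (nab (Profile.single j.1 (f j)) E') = B (nab (Profile.single j.1 (g j)) E')) →
    B (nab ⟨N, hN, f⟩ E) = B (nab ⟨N, hN, g⟩ E)

/-- (ESF-D), Dictator. -/
def ESFD (B : ℰ → Set W) (nab : Profile S ℰ → ℰ → ℰ) : Prop :=
  ∀ (N : Finset S) (hN : N.Nonempty), ∃ d : {x // x ∈ N},
    ∀ (f : {x // x ∈ N} → ℰ) (E : ℰ),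
      B (nab ⟨N, hN, f⟩ E) ⊆ B (nab (Profile.single d.1 (f d)) E)

/-- The maximal elements of `C` with respect to the total preorder `R`. -/
def MaxSet (C : Set W) (R : W → W → Prop) : Set W :=
  {w ∈ C | ∀ w' ∈ C, R w w'}

/-- The strict part of a total preorder. -/
def StrictRel (R : W → W → Prop) (a b : W) : Prop := R a b ∧ ¬ R b a

/-- An assignment: each profile is mapped to a total preorder over valuations. -/
def IsAssignment (f : Profile S ℰ → W → W → Prop) : Prop :=
  ∀ Φ : Profile S ℰ, (∀ a b : W, f Φ a b ∨ f Φ b a) ∧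
    (∀ a b c : W, f Φ a b → f Φ b c → f Φ a c)

/-- A basic assignment: an assignment sending equivalent profiles to equal preorders. -/
def IsBasicAssignment [LinearOrder S] (f : Profile S ℰ → W → W → Prop) : Prop :=
  IsAssignment f ∧ ∀ Φ Ψ : Profile S ℰ, Profile.Equiv Φ Ψ → f Φ = f Ψ

/-- The assignment `f` represents the operator `nab`. -/
def Represents (B : ℰ → Set W) (nab : Profile S ℰ → ℰ → ℰ)
    (f : Profile S ℰ → W → W → Prop) : Prop :=
  ∀ (Φ : Profile S ℰ) (E : ℰ), B (nab Φ E) = MaxSet (B E) (f Φ)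

/-- Property 1. -/
def Prop1 (f : Profile S ℰ → W → W → Prop) : Prop :=
  ∀ (j k : S) (Ej Ek : ℰ), Ej ≠ Ek →
    f (Profile.single j Ej) ≠ f (Profile.single k Ek)

/-- Property 2. -/
def Prop2 (B : ℰ → Set W) (f : Profile S ℰ → W → W → Prop) : Prop :=
  ∀ Φ : Profile S ℰ, (⋂ i : {x // x ∈ Φ.soc}, B (Φ.val i)).Nonempty →
    (⋂ i : {x // x ∈ Φ.soc}, B (Φ.val i)) = MaxSet Set.univ (f Φ)

/-- Property 3. -/
def Prop3 [DecidableEq S] (f : Profile S ℰ → W → W → Prop) : Prop :=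
  ∀ (Φ : Profile S ℰ) (N₁ N₂ : Finset S) (h₁ : N₁.Nonempty) (h₂ : N₂.Nonempty)
    (hs₁ : N₁ ⊆ Φ.soc) (hs₂ : N₂ ⊆ Φ.soc),
    Disjoint N₁ N₂ → N₁ ∪ N₂ = Φ.soc → ∀ w w' : W,
      f (Φ.restrict N₁ h₁ hs₁) w w' → f (Φ.restrict N₂ h₂ hs₂) w w' → f Φ w w'

/-- Property 4. -/
def Prop4 [DecidableEq S] (f : Profile S ℰ → W → W → Prop) : Prop :=
  ∀ (Φ : Profile S ℰ) (N₁ N₂ : Finset S) (h₁ : N₁.Nonempty) (h₂ : N₂.Nonempty)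
    (hs₁ : N₁ ⊆ Φ.soc) (hs₂ : N₂ ⊆ Φ.soc),
    Disjoint N₁ N₂ → N₁ ∪ N₂ = Φ.soc → ∀ w w' : W,
      f (Φ.restrict N₁ h₁ hs₁) w w' → StrictRel (f (Φ.restrict N₂ h₂ hs₂)) w w' →
        StrictRel (f Φ) w w'

/-- Property 4′. -/
def Prop4' [DecidableEq S] (f : Profile S ℰ → W → W → Prop) : Prop :=
  ∀ (Φ : Profile S ℰ) (N₁ N₂ : Finset S) (h₁ : N₁.Nonempty) (h₂ : N₂.Nonempty)
    (hs₁ : N₁ ⊆ Φ.soc) (hs₂ : N₂ ⊆ Φ.soc),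
    Disjoint N₁ N₂ → N₁ ∪ N₂ = Φ.soc → ∀ w w' : W,
      StrictRel (f (Φ.restrict N₁ h₁ hs₁)) w w' →
      StrictRel (f (Φ.restrict N₂ h₂ hs₂)) w w' →
        StrictRel (f Φ) w w'

/-- The Maximality Condition. -/
def Maximality (B : ℰ → Set W) (f : Profile S ℰ → W → W → Prop) : Prop :=
  ∀ (i : S) (E : ℰ), B E = MaxSet Set.univ (f (Profile.single i E))

/-- Faithful assignment: basic + Properties 1–4. -/
def IsFaithfulAssignment [LinearOrder S] (B : ℰ → Set W)
    (f : Profile S ℰ → W → W → Prop) : Prop :=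
  IsBasicAssignment f ∧ Prop1 f ∧ Prop2 B f ∧ Prop3 f ∧ Prop4 f

/-- Quasifaithful assignment: basic + Properties 1–3 and 4′. -/
def IsQuasifaithfulAssignment [LinearOrder S] (B : ℰ → Set W)
    (f : Profile S ℰ → W → W → Prop) : Prop :=
  IsBasicAssignment f ∧ Prop1 f ∧ Prop2 B f ∧ Prop3 f ∧ Prop4' f

/-- Property (u). -/
def PropU (f : Profile S ℰ → W → W → Prop) : Prop :=
  ∀ (Φ : Profile S ℰ), (∀ i j : {x // x ∈ Φ.soc}, Φ.val i = Φ.val j) →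
    ∀ i : {x // x ∈ Φ.soc}, f Φ = f (Profile.single i.1 (Φ.val i))

/-- Property (p). -/
def PropP (f : Profile S ℰ → W → W → Prop) : Prop :=
  ∀ (Φ : Profile S ℰ) (w w' : W),
    (∀ i : {x // x ∈ Φ.soc}, StrictRel (f (Profile.single i.1 (Φ.val i))) w w') →
    StrictRel (f Φ) w w'

/-- Two relations coincide on the pair `{w, w'}`. -/
def SameOnPair (R R' : W → W → Prop) (w w' : W) : Prop :=
  (R w w' ↔ R' w w') ∧ (R w' w ↔ R' w' w)

/-- Property (ind). -/
def PropInd (f : Profile S ℰ → W → W → Prop) : Prop :=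
  ∀ (N : Finset S) (hN : N.Nonempty) (g g' : {x // x ∈ N} → ℰ) (w w' : W),
    (∀ i : {x // x ∈ N},
      SameOnPair (f (Profile.single i.1 (g i))) (f (Profile.single i.1 (g' i))) w w') →
    SameOnPair (f ⟨N, hN, g⟩) (f ⟨N, hN, g'⟩) w w'

/-- Property (d). -/
def PropD (f : Profile S ℰ → W → W → Prop) : Prop :=
  ∀ (N : Finset S) (hN : N.Nonempty), ∃ d : {x // x ∈ N},
    ∀ (g : {x // x ∈ N} → ℰ) (w w' : W),
      StrictRel (f (Profile.single d.1 (g d))) w w' → StrictRel (f ⟨N, hN, g⟩) w w'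

/-- `D` is a locally decisive `N`-coalition for `E` against `E'`. -/
def LocallyDecisiveFor (B : ℰ → Set W) (nab : Profile S ℰ → ℰ → ℰ)
    (N : Finset S) (hN : N.Nonempty) (D : Finset S) (hD : D ⊆ N) (E E' : ℰ) : Prop :=
  ∀ f : {x // x ∈ N} → ℰ,
    (∀ i : {x // x ∈ D}, B (nab (Profile.single i.1 (f ⟨i.1, hD i.2⟩)) E) ∩ B E' = ∅) →
    (∀ j : {x // x ∈ N}, j.1 ∉ D → B (nab (Profile.single j.1 (f j)) E) = B E') →
    (⋂ i : {x // x ∈ D}, B (nab (Profile.single i.1 (f ⟨i.1, hD i.2⟩)) E)).Nonempty →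
    B (nab ⟨N, hN, f⟩ E) ∩ B E' = ∅

/-- `D` is a decisive `N`-coalition for `E` against `E'`. -/
def DecisiveFor (B : ℰ → Set W) (nab : Profile S ℰ → ℰ → ℰ)
    (N : Finset S) (hN : N.Nonempty) (D : Finset S) (hD : D ⊆ N) (E E' : ℰ) : Prop :=
  ∀ f : {x // x ∈ N} → ℰ,
    (∀ i : {x // x ∈ D}, B (nab (Profile.single i.1 (f ⟨i.1, hD i.2⟩)) E) ∩ B E' = ∅) →
    (⋂ i : {x // x ∈ D}, B (nab (Profile.single i.1 (f ⟨i.1, hD i.2⟩)) E)).Nonempty →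
    B (nab ⟨N, hN, f⟩ E) ∩ B E' = ∅

/-- `D` is a decisive `N`-coalition. -/
def DecisiveCoalition (B : ℰ → Set W) (nab : Profile S ℰ → ℰ → ℰ)
    (N : Finset S) (hN : N.Nonempty) (D : Finset S) (hD : D ⊆ N) : Prop :=
  ∀ E E' : ℰ, DecisiveFor B nab N hN D hD E E'

end BeliefMerging

namespace BeliefMerging

section Representation

variable {S ℰ W : Type} {B : ℰ → Set W} {nab : Profile S ℰ → ℰ → ℰ}
  {f : Profile S ℰ → W → W → Prop}

lemma IsAssignment.refl (hf : IsAssignment f) (Φ : Profile S ℰ) (a : W) : f Φ a a :=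
  ((hf Φ).1 a a).elim id id

/-- A represented operator determines the preorder through its values on pairs. -/
lemma Represents.rel_iff (hr : Represents B nab f) (hf : IsAssignment f) (Φ : Profile S ℰ)
    {E : ℰ} {a b : W} (hE : B E = {a, b}) : f Φ a b ↔ a ∈ B (nab Φ E) := by
  rw [hr Φ E, hE]
  constructor
  · intro h
    refine ⟨by simp, ?_⟩
    rintro c (rfl | rfl)
    · exact hf.refl Φ _
    · exact h
  · intro h
    exact h.2 b (by simp)

lemma Represents.unique {g : Profile S ℰ → W → W → Prop}
    (hsurj : ∀ A : Set W, A.Nonempty → ∃ E : ℰ, B E = A)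
    (hr : Represents B nab f) (hf : IsAssignment f)
    (hr' : Represents B nab g) (hg : IsAssignment g) : g = f := by
  funext Φ a b
  obtain ⟨E, hE⟩ := hsurj {a, b} ⟨a, by simp⟩
  exact propext ((hr'.rel_iff hg Φ hE).trans (hr.rel_iff hf Φ hE).symm)

/-- An element at least as good as a maximal one is maximal. -/
lemma mem_maxSet_of_rel {R : W → W → Prop} (ht : ∀ a b c, R a b → R b c → R a c)
    {C : Set W} {a b : W} (ha : a ∈ C) (hb : b ∈ MaxSet C R) (h : R a b) : a ∈ MaxSet C R :=
  ⟨ha, fun c hc => ht _ _ _ h (hb.2 c hc)⟩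

/-- The relation revealed by the choices of the operator on pairs. -/
def revealed (B : ℰ → Set W) (nab : Profile S ℰ → ℰ → ℰ) (Φ : Profile S ℰ) (a b : W) : Prop :=
  ∃ E : ℰ, B E = {a, b} ∧ a ∈ B (nab Φ E)

lemma BasicFusion.revealed_of_mem [LinearOrder S] (h : BasicFusion B nab)
    (hsurj : ∀ A : Set W, A.Nonempty → ∃ E : ℰ, B E = A)
    {Φ : Profile S ℰ} {E : ℰ} {a b : W} (ha : a ∈ B (nab Φ E)) (hb : b ∈ B E) :
    revealed B nab Φ a b := by
  obtain ⟨E', hE'⟩ := hsurj {a, b} ⟨a, by simp⟩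
  refine ⟨E', hE', h.2.2.1 Φ E' E E' ?_ ⟨ha, by simp [hE']⟩⟩
  rw [eq_comm, Set.inter_eq_right, hE']
  rintro c (rfl | rfl)
  · exact h.1 Φ E ha
  · exact hb

lemma BasicFusion.mem_of_revealed [LinearOrder S] (h : BasicFusion B nab)
    {Φ : Profile S ℰ} {E : ℰ} {a b : W} (ha : a ∈ B E) (hb : b ∈ B (nab Φ E))
    (hab : revealed B nab Φ a b) : a ∈ B (nab Φ E) := by
  obtain ⟨E', hE', ha'⟩ := hab
  refine (h.2.2.2 Φ E' E E' ?_ ⟨b, hb, by simp [hE']⟩ ha').1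
  rw [eq_comm, Set.inter_eq_right, hE']
  rintro c (rfl | rfl)
  · exact ha
  · exact h.1 Φ E hb

lemma BasicFusion.represents_revealed [LinearOrder S] (h : BasicFusion B nab)
    (hB : ∀ E : ℰ, (B E).Nonempty)
    (hsurj : ∀ A : Set W, A.Nonempty → ∃ E : ℰ, B E = A) :
    Represents B nab (revealed B nab) := by
  intro Φ E
  ext a
  constructor
  · exact fun ha => ⟨h.1 Φ E ha, fun b hb => h.revealed_of_mem hsurj ha hb⟩
  · intro ha
    obtain ⟨u, hu⟩ := hB (nab Φ E)
    exact h.mem_of_revealed ha.1 hu (ha.2 u (h.1 Φ E hu))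

lemma BasicFusion.isAssignment_revealed [LinearOrder S] (h : BasicFusion B nab)
    (hB : ∀ E : ℰ, (B E).Nonempty)
    (hsurj : ∀ A : Set W, A.Nonempty → ∃ E : ℰ, B E = A) :
    IsAssignment (revealed B nab) := by
  intro Φ
  constructor
  · intro a b
    obtain ⟨E, hE⟩ := hsurj {a, b} ⟨a, by simp⟩
    obtain ⟨u, hu⟩ := hB (nab Φ E)
    have huE := h.1 Φ E hu
    rw [hE] at huE
    rcases huE with rfl | rfl
    · exact Or.inl (h.revealed_of_mem hsurj hu (by simp [hE]))
    · exact Or.inr (h.revealed_of_mem hsurj hu (by simp [hE]))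
  · intro a b c hab hbc
    obtain ⟨E, hE⟩ := hsurj {a, b, c} ⟨a, by simp⟩
    obtain ⟨u, hu⟩ := hB (nab Φ E)
    have huE := h.1 Φ E hu
    rw [hE] at huE
    have ha : a ∈ B E := by simp [hE]
    have hb : b ∈ B E := by simp [hE]
    have hc : c ∈ B E := by simp [hE]
    refine h.revealed_of_mem hsurj (E := E) ?_ hc
    rcases huE with rfl | rfl | rfl
    · exact hu
    · exact h.mem_of_revealed ha hu hab
    · exact h.mem_of_revealed ha (h.mem_of_revealed hb hu hbc) hab

lemma BasicFusion.isBasicAssignment_revealed [LinearOrder S] (h : BasicFusion B nab)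
    (hB : ∀ E : ℰ, (B E).Nonempty)
    (hsurj : ∀ A : Set W, A.Nonempty → ∃ E : ℰ, B E = A) :
    IsBasicAssignment (revealed B nab) := by
  refine ⟨h.isAssignment_revealed hB hsurj, fun Φ Ψ hΦ => ?_⟩
  funext a b
  refine propext (exists_congr fun E => and_congr_right fun _ => ?_)
  rw [h.2.1 Φ Ψ E E hΦ rfl]

lemma Represents.basicFusion [LinearOrder S] (hr : Represents B nab f)
    (hf : IsBasicAssignment f) : BasicFusion B nab := by
  refine ⟨fun Φ E w hw => ?_, fun Φ Φ' E E' hΦ hE => ?_, ?_, ?_⟩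
  · rw [hr] at hw
    exact hw.1
  · rw [hr, hr, hf.2 Φ Φ' hΦ, hE]
  · intro Φ E E' E'' hE w hw
    rw [hr] at hw ⊢
    rw [hE]
    exact ⟨⟨hw.1.1, hw.2⟩, fun c hc => hw.1.2 c hc.1⟩
  · rintro Φ E E' E'' hE ⟨u, hu, hu'⟩ w hw
    rw [hr] at hu hw ⊢
    rw [hE] at hw
    exact ⟨mem_maxSet_of_rel (hf.1 Φ).2 hw.1.1 hu (hw.2 u ⟨hu.1, hu'⟩), hw.1.2⟩

lemma Represents.esf5_iff (hsurj : ∀ A : Set W, A.Nonempty → ∃ E : ℰ, B E = A)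
    (hr : Represents B nab f) (hf : IsAssignment f) : ESF5 B nab ↔ Prop1 f := by
  refine forall₄_congr fun j k Ej Ek => imp_congr_right fun _ => ?_
  constructor
  · rintro ⟨E, hE⟩ h
    exact hE (by rw [hr, hr, h])
  · intro h
    by_contra! hc
    refine h ?_
    funext a b
    obtain ⟨E, hE⟩ := hsurj {a, b} ⟨a, by simp⟩
    rw [hr.rel_iff hf _ hE, hr.rel_iff hf _ hE, hc E]

lemma Represents.esf6_iff [Nonempty W] (hsurj : ∀ A : Set W, A.Nonempty → ∃ E : ℰ, B E = A)
    (hr : Represents B nab f) (hf : IsAssignment f) : ESF6 B nab ↔ Prop2 B f := by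
  constructor
  · intro h Φ hΦ
    obtain ⟨E, hE⟩ := hsurj Set.univ Set.univ_nonempty
    have := h Φ E (by simpa [hE] using hΦ)
    rw [hr, hE, Set.inter_univ] at this
    exact this.symm
  · rintro h Φ E ⟨u, hu, huE⟩
    rw [hr, h Φ ⟨u, hu⟩]
    rw [h Φ ⟨u, hu⟩] at hu
    ext w
    constructor
    · exact fun hw => ⟨mem_maxSet_of_rel (hf Φ).2 trivial hu (hw.2 u huE), hw.1⟩
    · exact fun hw => ⟨hw.2, fun c _ => hw.1.2 c trivial⟩

lemma Represents.esf7_iff [DecidableEq S]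
    (hsurj : ∀ A : Set W, A.Nonempty → ∃ E : ℰ, B E = A)
    (hr : Represents B nab f) (hf : IsAssignment f) : ESF7 B nab ↔ Prop3 f := by
  constructor
  · intro h Φ N₁ N₂ h₁ h₂ hs₁ hs₂ hd hu a b h1 h2
    obtain ⟨E, hE⟩ := hsurj {a, b} ⟨a, by simp⟩
    rw [hr.rel_iff hf _ hE] at h1 h2 ⊢
    exact h Φ N₁ N₂ h₁ h₂ hs₁ hs₂ hd hu E ⟨h1, h2⟩
  · intro h Φ N₁ N₂ h₁ h₂ hs₁ hs₂ hd hu E w hw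
    rw [hr, hr] at hw
    rw [hr]
    exact ⟨hw.1.1, fun c hc =>
      h Φ N₁ N₂ h₁ h₂ hs₁ hs₂ hd hu w c (hw.1.2 c hc) (hw.2.2 c hc)⟩

lemma Represents.esf8W_iff [DecidableEq S]
    (hsurj : ∀ A : Set W, A.Nonempty → ∃ E : ℰ, B E = A)
    (hr : Represents B nab f) (hf : IsAssignment f) : ESF8W B nab ↔ Prop4' f := by
  constructor
  · rintro h Φ N₁ N₂ h₁ h₂ hs₁ hs₂ hd hu a b ⟨h1, h1'⟩ ⟨h2, h2'⟩
    obtain ⟨E, hE⟩ := hsurj {a, b} ⟨a, by simp⟩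
    have hE' : B E = {b, a} := hE.trans (Set.pair_comm a b)
    rw [hr.rel_iff hf _ hE] at h1 h2
    rw [hr.rel_iff hf _ hE'] at h1' h2'
    have hba : ¬ f Φ b a := by
      rw [hr.rel_iff hf _ hE']
      intro hb
      exact (h Φ N₁ N₂ h₁ h₂ hs₁ hs₂ hd hu E ⟨a, h1, h2⟩ hb).elim h1' h2'
    exact ⟨((hf Φ).1 a b).resolve_right hba, hba⟩
  · rintro h Φ N₁ N₂ h₁ h₂ hs₁ hs₂ hd hu E ⟨u, hu1, hu2⟩ w hw
    by_contra hc
    rw [hr] at hu1 hu2 hw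
    rw [Set.mem_union, hr, hr, not_or] at hc
    refine (h Φ N₁ N₂ h₁ h₂ hs₁ hs₂ hd hu u w ⟨hu1.2 w hw.1, fun hwu => ?_⟩
      ⟨hu2.2 w hw.1, fun hwu => ?_⟩).2 (hw.2 u hu1.1)
    · exact hc.1 (mem_maxSet_of_rel (hf _).2 hw.1 hu1 hwu)
    · exact hc.2 (mem_maxSet_of_rel (hf _).2 hw.1 hu2 hwu)

/-- Quasifusion postulates correspond to quasifaithfulness of a representing basic assignment. -/
lemma Represents.quasifusion_iff [LinearOrder S] [Nonempty W]
    (hsurj : ∀ A : Set W, A.Nonempty → ∃ E : ℰ, B E = A)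
    (hr : Represents B nab f) (hf : IsBasicAssignment f) :
    Quasifusion B nab ↔ IsQuasifaithfulAssignment B f := by
  rw [Quasifusion, IsQuasifaithfulAssignment, hr.esf5_iff hsurj hf.1, hr.esf6_iff hsurj hf.1,
    hr.esf7_iff hsurj hf.1, hr.esf8W_iff hsurj hf.1]
  exact and_congr_left fun _ => iff_of_true (hr.basicFusion hf) hf

end Representation

end BeliefMerging

open BeliefMerging in
/-- Weak representation theorem for ES quasifusion operators. -/
theorem weak_representation_quasifusion
    {S ℰ W : Type} [LinearOrder S] [Nonempty S] [Fintype W] [Nonempty W]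
    (B : ℰ → Set W) (hB : ∀ E : ℰ, (B E).Nonempty)
    (hsurj : ∀ A : Set W, A.Nonempty → ∃ E : ℰ, B E = A)
    (nab : Profile S ℰ → ℰ → ℰ) :
    Quasifusion B nab ↔
      ∃! f : Profile S ℰ → W → W → Prop,
        IsQuasifaithfulAssignment B f ∧ Represents B nab f := by
  constructor
  · intro h
    have hr := h.1.represents_revealed hB hsurj
    have hf := h.1.isBasicAssignment_revealed hB hsurj
    exact ⟨revealed B nab, ⟨(hr.quasifusion_iff hsurj hf).1 h, hr⟩,
      fun g hg => hr.unique hsurj hf.1 hg.2 hg.1.1.1⟩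
  · rintro ⟨f, ⟨hf, hr⟩, -⟩
    exact (hr.quasifusion_iff hsurj hf.1).2 hf
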